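/- Let λ be a composition of r. In the Hecke-Clifford superalgebra H^c_{r,R}, the right ideal x_λ H^c_{r,R} equals {h ∈ H^c_{r,R} : T_{s_k} h = q h for all simple transpositions s_k ∈ S_λ}, where x_λ = Σ_{w ∈ S_λ} T_w. -/

import Mathlib

namespace HCPaper

noncomputable section

open MulOpposite

/-- Generators of the Hecke-Clifford superalgebra: `Sum.inl i` is `T_{i+1}` (0-based `i < r-1`),
`Sum.inr j` is `c_{j+1}` (0-based `j < r`). -/
abbrev Gen (r : ℕ) := (Fin (r - 1)) ⊕ (Fin r)

/-- The index `i` viewed in `Fin r` (the first of the two indices moved by `T_i`). -/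
def loIdx {r : ℕ} (i : Fin (r - 1)) : Fin r := ⟨i.val, by have := i.isLt; omega⟩

/-- The index `i+1` viewed in `Fin r`. -/
def hiIdx {r : ℕ} (i : Fin (r - 1)) : Fin r := ⟨i.val + 1, by have := i.isLt; omega⟩

def Tf (R : Type) [CommRing R] (r : ℕ) (i : Fin (r - 1)) : FreeAlgebra R (Gen r) :=
  FreeAlgebra.ι R (Sum.inl i)

def Cf (R : Type) [CommRing R] (r : ℕ) (j : Fin r) : FreeAlgebra R (Gen r) :=
  FreeAlgebra.ι R (Sum.inr j)

/-- The defining relations of the Hecke-Clifford superalgebra `H^c_{r,R}`. -/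
inductive HCRel (R : Type) [CommRing R] (q : R) (r : ℕ) :
    FreeAlgebra R (Gen r) → FreeAlgebra R (Gen r) → Prop
  | csq (j : Fin r) : HCRel R q r (Cf R r j * Cf R r j) (-1)
  | canti (i j : Fin r) (h : i ≠ j) :
      HCRel R q r (Cf R r i * Cf R r j) (-(Cf R r j * Cf R r i))
  | quad (i : Fin (r - 1)) :
      HCRel R q r ((Tf R r i - algebraMap R _ q) * (Tf R r i + 1)) 0
  | commTT (i i' : Fin (r - 1)) (h : i.val + 1 < i'.val) :
      HCRel R q r (Tf R r i * Tf R r i') (Tf R r i' * Tf R r i)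
  | braid (i i' : Fin (r - 1)) (h : i'.val = i.val + 1) :
      HCRel R q r (Tf R r i * Tf R r i' * Tf R r i) (Tf R r i' * Tf R r i * Tf R r i')
  | commTC (i : Fin (r - 1)) (j : Fin r) (h1 : j.val ≠ i.val) (h2 : j.val ≠ i.val + 1) :
      HCRel R q r (Tf R r i * Cf R r j) (Cf R r j * Tf R r i)
  | TClo (i : Fin (r - 1)) :
      HCRel R q r (Tf R r i * Cf R r (loIdx i)) (Cf R r (hiIdx i) * Tf R r i)
  | TChi (i : Fin (r - 1)) :
      HCRel R q r (Tf R r i * Cf R r (hiIdx i))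
        (Cf R r (loIdx i) * Tf R r i -
          algebraMap R _ (q - 1) * (Cf R r (loIdx i) - Cf R r (hiIdx i)))

/-- The Hecke-Clifford superalgebra `H^c_{r,R}` with parameter `q`, as a quotient of
the free algebra by the defining relations. -/
abbrev HC (R : Type) [CommRing R] (q : R) (r : ℕ) := RingQuot (HCRel R q r)

/-- The generator `T_{i+1}` of `H^c_{r,R}` (0-based index). -/
def TT (R : Type) [CommRing R] (q : R) (r : ℕ) (i : Fin (r - 1)) : HC R q r :=
  RingQuot.mkAlgHom R (HCRel R q r) (Tf R r i)

/-- The generator `c_{j+1}` of `H^c_{r,R}` (0-based index). -/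
def CC (R : Type) [CommRing R] (q : R) (r : ℕ) (j : Fin r) : HC R q r :=
  RingQuot.mkAlgHom R (HCRel R q r) (Cf R r j)

end

end HCPaper
namespace HCPaper

/-- The Coxeter length of a permutation of `Fin r`: its number of inversions. -/
def len {r : ℕ} (w : Equiv.Perm (Fin r)) : ℕ :=
  (Finset.univ.filter fun p : Fin r × Fin r => p.1 < p.2 ∧ w p.2 < w p.1).card

/-- The simple transposition `s_{k+1} = (k+1, k+2)` (0-based `k < r-1`) as a permutation. -/
def simpleT {r : ℕ} (k : Fin (r - 1)) : Equiv.Perm (Fin r) :=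
  Equiv.swap (loIdx k) (hiIdx k)

/-- Partial sum `λ_1 + ⋯ + λ_k` of a composition. -/
def psum {n : ℕ} (lam : Fin n → ℕ) (k : ℕ) : ℕ :=
  ∑ i : Fin n, if (i : ℕ) < k then lam i else 0

/-- `j` (0-based) lies in the `k`-th block `R^λ_{k+1}` of the composition `λ`. -/
def InBlock {n r : ℕ} (lam : Fin n → ℕ) (k : Fin n) (j : Fin r) : Prop :=
  psum lam (k : ℕ) ≤ (j : ℕ) ∧ (j : ℕ) < psum lam (k : ℕ) + lam k

instance {n r : ℕ} (lam : Fin n → ℕ) (k : Fin n) (j : Fin r) : Decidable (InBlock lam k j) := by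
  unfold InBlock; infer_instance

/-- Membership in the Young subgroup `S_λ`: `w` preserves each block of `λ`. -/
def MemYoung {n r : ℕ} (lam : Fin n → ℕ) (w : Equiv.Perm (Fin r)) : Prop :=
  ∀ (k : Fin n) (j : Fin r), InBlock lam k j → InBlock lam k (w j)

instance {n r : ℕ} (lam : Fin n → ℕ) (w : Equiv.Perm (Fin r)) : Decidable (MemYoung lam w) := by
  unfold MemYoung; infer_instance

/-- `d` is the minimal length element of the double coset `S_λ d S_μ`. -/
def MinDouble {r n1 n2 : ℕ} (lam : Fin n1 → ℕ) (mu : Fin n2 → ℕ) (d : Equiv.Perm (Fin r)) :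
    Prop :=
  ∀ u σ : Equiv.Perm (Fin r), MemYoung lam u → MemYoung mu σ → len d ≤ len (u * d * σ)

end HCPaper
namespace HCPaper

noncomputable section

/-- `TW` is the standard basis `w ↦ T_w` of the Hecke subalgebra of `H^c_{r,R}`:
`T_1 = 1` and `T_{w s_k} = T_w T_{s_k}` whenever `ℓ(w s_k) = ℓ(w) + 1`. -/
def IsTW {R : Type} [CommRing R] (q : R) (r : ℕ) (TW : Equiv.Perm (Fin r) → HC R q r) :
    Prop :=
  TW 1 = 1 ∧ ∀ (w : Equiv.Perm (Fin r)) (k : Fin (r - 1)),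
    len (w * simpleT k) = len w + 1 → TW (w * simpleT k) = TW w * TT R q r k

/-- The element `x_λ = ∑_{w ∈ S_λ} T_w` of `H^c_{r,R}`. -/
def xElt {R : Type} [CommRing R] {q : R} {r n : ℕ} (lam : Fin n → ℕ)
    (TW : Equiv.Perm (Fin r) → HC R q r) : HC R q r :=
  ∑ w : Equiv.Perm (Fin r), if MemYoung lam w then TW w else 0

/-- The element `c_{q,r} = q^{r-1} c_1 + q^{r-2} c_2 + ⋯ + c_r` of `H^c_{r,R}`. -/
def cqr (R : Type) [CommRing R] (q : R) (r : ℕ) : HC R q r :=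
  ∑ j : Fin r, q ^ (r - 1 - (j : ℕ)) • CC R q r j

/-- The element `c'_{q,r} = c_1 + q c_2 + ⋯ + q^{r-1} c_r` of `H^c_{r,R}`. -/
def cqr' (R : Type) [CommRing R] (q : R) (r : ℕ) : HC R q r :=
  ∑ j : Fin r, q ^ (j : ℕ) • CC R q r j

end

end HCPaper

namespace HCPaper

section Comb

variable {r : ℕ}

lemma lo_lt_hi (k : Fin (r - 1)) : loIdx k < hiIdx k := by
  simp [loIdx, hiIdx, Fin.lt_def]

lemma simpleT_lo (k : Fin (r - 1)) : simpleT k (loIdx k) = hiIdx k := by simp [simpleT]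

lemma simpleT_hi (k : Fin (r - 1)) : simpleT k (hiIdx k) = loIdx k := by simp [simpleT]

lemma simpleT_other (k : Fin (r - 1)) {x : Fin r} (h1 : x ≠ loIdx k) (h2 : x ≠ hiIdx k) :
    simpleT k x = x := by simp [simpleT, Equiv.swap_apply_of_ne_of_ne h1 h2]

lemma simpleT_sq (k : Fin (r - 1)) : simpleT k * simpleT k = (1 : Equiv.Perm (Fin r)) := by
  simp [simpleT]

lemma simpleT_inv (k : Fin (r - 1)) : (simpleT k)⁻¹ = (simpleT k : Equiv.Perm (Fin r)) := by
  simp [simpleT]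

lemma simpleT_simpleT (k : Fin (r - 1)) (x : Fin r) : simpleT k (simpleT k x) = x := by
  simp [simpleT]

/-- a simple transposition preserves the order of all pairs but one -/
lemma simpleT_lt (k : Fin (r - 1)) {x y : Fin r} (h : x < y)
    (hne : ¬ (x = loIdx k ∧ y = hiIdx k)) : simpleT k x < simpleT k y := by
  have key : ∀ z : Fin r, (simpleT k z).val =
      if z.val = k.val then k.val + 1 else if z.val = k.val + 1 then k.val else z.val := by
    intro z
    split_ifs with h1 h2
    · have : z = loIdx k := Fin.ext h1
      rw [this, simpleT_lo]; rfl
    · have : z = hiIdx k := Fin.ext h2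
      rw [this, simpleT_hi]; rfl
    · rw [simpleT_other]
      · exact fun h => h1 (congrArg Fin.val h)
      · exact fun h => h2 (congrArg Fin.val h)
  have hne' : ¬ (x.val = k.val ∧ y.val = k.val + 1) :=
    fun ⟨a, b⟩ => hne ⟨Fin.ext a, Fin.ext b⟩
  rw [Fin.lt_def] at h ⊢
  rw [key, key]
  split_ifs <;> omega

lemma len_asc (w : Equiv.Perm (Fin r)) (k : Fin (r - 1)) (h : w (loIdx k) < w (hiIdx k)) :
    len (w * simpleT k) = len w + 1 := by
  unfold len
  set S := Finset.univ.filter fun p : Fin r × Fin r => p.1 < p.2 ∧ w p.2 < w p.1 with hS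
  let f : Fin r × Fin r ↪ Fin r × Fin r :=
    ((simpleT k).prodCongr (simpleT k)).toEmbedding
  have hf : ∀ p, f p = (simpleT k p.1, simpleT k p.2) := fun p => rfl
  have hnot : (loIdx k, hiIdx k) ∉ S.map f := by
    intro hm
    obtain ⟨p, hp, hpe⟩ := Finset.mem_map.1 hm
    rw [hf, Prod.mk.injEq] at hpe
    have h1 : p.1 = hiIdx k := by rw [← simpleT_lo, ← hpe.1, simpleT_simpleT]
    have h2 : p.2 = loIdx k := by rw [← simpleT_hi, ← hpe.2, simpleT_simpleT]
    have := (Finset.mem_filter.1 hp).2.1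
    rw [h1, h2] at this
    exact absurd this (lo_lt_hi k).asymm
  have : (Finset.univ.filter fun p : Fin r × Fin r =>
      p.1 < p.2 ∧ (w * simpleT k) p.2 < (w * simpleT k) p.1)
      = Finset.cons (loIdx k, hiIdx k) (S.map f) hnot := by
    ext ⟨x, y⟩
    rw [Finset.mem_filter, Finset.mem_cons, Finset.mem_map]
    simp only [Finset.mem_univ, true_and, Equiv.Perm.mul_apply, Prod.mk.injEq]
    constructor
    · rintro ⟨hxy, hw⟩
      by_cases hc : x = loIdx k ∧ y = hiIdx k
      · exact Or.inl hc
      · right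
        refine ⟨(simpleT k x, simpleT k y), ?_, ?_⟩
        · rw [hS, Finset.mem_filter]
          exact ⟨Finset.mem_univ _, simpleT_lt k hxy hc, hw⟩
        · rw [hf, simpleT_simpleT, simpleT_simpleT]
    · rintro (⟨rfl, rfl⟩ | ⟨p, hp, hpe⟩)
      · rw [simpleT_lo, simpleT_hi]
        exact ⟨lo_lt_hi k, h⟩
      · rw [hf, Prod.mk.injEq] at hpe
        obtain ⟨rfl, rfl⟩ := hpe
        rw [simpleT_simpleT, simpleT_simpleT]
        obtain ⟨h1, h2⟩ := (Finset.mem_filter.1 hp).2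
        refine ⟨simpleT_lt k h1 ?_, h2⟩
        rintro ⟨e1, e2⟩
        rw [e1, e2] at h2
        exact absurd h h2.asymm
  rw [this, Finset.card_cons, Finset.card_map]

lemma exists_desc (w : Equiv.Perm (Fin r)) (hw : w ≠ 1) :
    ∃ k : Fin (r - 1), w (hiIdx k) < w (loIdx k) := by
  by_contra hcon
  push Not at hcon
  apply hw
  have hmono : StrictMono w := by
    match r, w, hcon with
    | 0, w, _ => exact fun a => a.elim0
    | n + 1, w, hcon =>
      rw [Fin.strictMono_iff_lt_succ]
      intro i
      have := hcon (⟨i.val, by simp⟩ : Fin (n + 1 - 1))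
      refine lt_of_le_of_ne this ?_
      intro he
      have := w.injective he
      simp [Fin.ext_iff] at this
  let o : Fin r ≃o Fin r := ⟨w, fun {a b} => hmono.le_iff_le⟩
  have ho : o = OrderIso.refl _ := Subsingleton.elim _ _
  ext x
  have : o x = x := by rw [ho]; rfl
  exact congrArg Fin.val this

lemma desc_eq (w : Equiv.Perm (Fin r)) (k : Fin (r - 1)) : w = w * simpleT k * simpleT k := by
  rw [mul_assoc, simpleT_sq, mul_one]

lemma len_desc (w : Equiv.Perm (Fin r)) (k : Fin (r - 1)) (h : w (hiIdx k) < w (loIdx k)) :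
    len (w * simpleT k) + 1 = len w := by
  have := len_asc (w * simpleT k) k (by simpa [simpleT_lo, simpleT_hi] using h)
  rw [← desc_eq] at this
  exact this.symm

lemma perm_induct {P : Equiv.Perm (Fin r) → Prop} (h1 : P 1)
    (hs : ∀ w k, w (loIdx k) < w (hiIdx k) → P w → P (w * simpleT k)) : ∀ w, P w := by
  have : ∀ n, ∀ w : Equiv.Perm (Fin r), len w = n → P w := by
    intro n
    induction n using Nat.strong_induction_on with
    | _ n ih =>
      intro w hn
      by_cases hw : w = 1
      · rw [hw]; exact h1
      · obtain ⟨k, hk⟩ := exists_desc w hw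
        rw [desc_eq w k]
        apply hs
        · simpa [simpleT_lo, simpleT_hi] using hk
        · exact ih _ (by have := len_desc w k hk; omega) _ rfl
  exact fun w => this _ w rfl

end Comb

section Clif

variable (R : Type) [CommRing R] (r : ℕ)

inductive CRel : FreeAlgebra R (Fin r) → FreeAlgebra R (Fin r) → Prop
  | csq (j : Fin r) : CRel (FreeAlgebra.ι R j * FreeAlgebra.ι R j) (-1)
  | canti (i j : Fin r) (h : i ≠ j) :
      CRel (FreeAlgebra.ι R i * FreeAlgebra.ι R j) (-(FreeAlgebra.ι R j * FreeAlgebra.ι R i))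

abbrev CA := RingQuot (CRel R r)

noncomputable def cgen (j : Fin r) : CA R r :=
  RingQuot.mkAlgHom R (CRel R r) (FreeAlgebra.ι R j)

lemma cgen_sq (j : Fin r) : cgen R r j * cgen R r j = -1 := by
  have := RingQuot.mkAlgHom_rel R (CRel.csq (R := R) j)
  simpa [cgen] using this

lemma cgen_anti (i j : Fin r) (h : i ≠ j) :
    cgen R r i * cgen R r j = -(cgen R r j * cgen R r i) := by
  have := RingQuot.mkAlgHom_rel R (CRel.canti (R := R) i j h)
  simpa [cgen] using this

lemma cgen_adjoin : Algebra.adjoin R (Set.range (cgen R r)) = ⊤ := by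
  have h := FreeAlgebra.adjoin_range_ι R (Fin r)
  have h2 := congrArg (Subalgebra.map (RingQuot.mkAlgHom R (CRel R r))) h
  rw [AlgHom.map_adjoin, Algebra.map_top,
    (AlgHom.range_eq_top _).2 (RingQuot.mkAlgHom_surjective R _), ← Set.range_comp] at h2
  exact h2

variable {R r}

noncomputable def clift {B : Type} [Ring B] [Algebra R B] (f : Fin r → B)
    (hsq : ∀ j, f j * f j = -1) (hanti : ∀ i j, i ≠ j → f i * f j = -(f j * f i)) :
    CA R r →ₐ[R] B :=
  RingQuot.liftAlgHom R ⟨FreeAlgebra.lift R f, by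
    intro x y h
    cases h with
    | csq j => simpa using hsq j
    | canti i j h => simpa using hanti i j h⟩

lemma clift_cgen {B : Type} [Ring B] [Algebra R B] (f : Fin r → B)
    (hsq : ∀ j, f j * f j = -1) (hanti : ∀ i j, i ≠ j → f i * f j = -(f j * f i)) (j : Fin r) :
    clift (R := R) f hsq hanti (cgen R r j) = f j := by
  simp [clift, cgen]

variable (R r) in
/-- the abstract data on Clifford algebra -/
structure CData (A : Type) [Ring A] [Algebra R A] where
  c : Fin r → A
  gen : Algebra.adjoin R (Set.range c) = ⊤
  csq : ∀ j, c j * c j = -1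
  canti : ∀ i j, i ≠ j → c i * c j = -(c j * c i)
  σ : Fin (r - 1) → A →ₗ[R] A
  δ : Fin (r - 1) → A →ₗ[R] A
  σ_one : ∀ k, σ k 1 = 1
  δ_one : ∀ k, δ k 1 = 0
  σ_mul : ∀ k a b, σ k (a * b) = σ k a * σ k b
  δ_mul : ∀ k a b, δ k (a * b) = a * δ k b + δ k a * σ k b
  σ_c : ∀ k j, σ k (c j) = c (simpleT k j)
  δ_c : ∀ k j, δ k (c j) = if j = loIdx k then c (loIdx k) - c (hiIdx k) else 0

noncomputable def dval (k : Fin (r - 1)) (j : Fin r) : CA R r :=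
  if j = loIdx k then cgen R r (loIdx k) - cgen R r (hiIdx k) else 0

lemma dval_lo (k : Fin (r - 1)) :
    dval (R := R) k (loIdx k) = cgen R r (loIdx k) - cgen R r (hiIdx k) := by simp [dval]

lemma dval_ne (k : Fin (r - 1)) {j : Fin r} (h : j ≠ loIdx k) :
    dval (R := R) k j = 0 := by simp [dval, h]

noncomputable def Dmat (k : Fin (r - 1)) (j : Fin r) : Matrix (Fin 2) (Fin 2) (CA R r) :=
  !![cgen R r j, dval k j; 0, cgen R r (simpleT k j)]

lemma Dmat_aux (k : Fin (r - 1)) (j : Fin r) (hj : loIdx k ≠ j) :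
    cgen R r (loIdx k) * dval k j + dval k (loIdx k) * cgen R r (simpleT k j)
      = -(cgen R r j * dval k (loIdx k) + dval k j * cgen R r (simpleT k (loIdx k))) := by
  rw [dval_ne k hj.symm, dval_lo]
  by_cases h : j = hiIdx k
  · subst h
    rw [simpleT_hi]
    simp only [mul_zero, zero_mul, mul_sub, sub_mul, cgen_sq]
    abel
  · rw [simpleT_other k hj.symm h]
    simp only [mul_zero, zero_mul, mul_sub, sub_mul, cgen_anti R r (loIdx k) j hj,
      cgen_anti R r (hiIdx k) j (Ne.symm h)]
    abel

lemma Dmat_sq (k : Fin (r - 1)) (j : Fin r) : Dmat (R := R) k j * Dmat k j = -1 := by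
  have h : cgen R r j * dval k j + dval k j * cgen R r (simpleT k j) = 0 := by
    by_cases h : j = loIdx k
    · subst h
      rw [dval_lo, simpleT_lo]
      simp only [mul_sub, sub_mul, cgen_sq]
      abel
    · rw [dval_ne k h]; simp
  rw [Dmat, Matrix.mul_fin_two, h, cgen_sq, cgen_sq, Matrix.one_fin_two]
  ext i j
  fin_cases i <;> fin_cases j <;> simp

lemma Dmat_anti (k : Fin (r - 1)) (i j : Fin r) (hij : i ≠ j) :
    Dmat (R := R) k i * Dmat k j = -(Dmat k j * Dmat k i) := by
  have h : cgen R r i * dval k j + dval k i * cgen R r (simpleT k j)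
      = -(cgen R r j * dval k i + dval k j * cgen R r (simpleT k i)) := by
    by_cases h1 : i = loIdx k
    · subst h1; exact Dmat_aux k j hij
    · by_cases h2 : j = loIdx k
      · subst h2
        rw [Dmat_aux k i hij.symm, neg_neg]
      · rw [dval_ne k h1, dval_ne k h2]; simp
  have h3 : simpleT k i ≠ simpleT k j := fun e => hij ((simpleT k).injective e)
  rw [Dmat, Dmat, Matrix.mul_fin_two, Matrix.mul_fin_two, h, cgen_anti R r i j hij,
    cgen_anti R r _ _ h3]
  ext i j
  fin_cases i <;> fin_cases j <;> simp

noncomputable def Dhom (k : Fin (r - 1)) : CA R r →ₐ[R] Matrix (Fin 2) (Fin 2) (CA R r) :=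
  clift (Dmat k) (Dmat_sq k) (Dmat_anti k)

lemma Dhom_c (k : Fin (r - 1)) (j : Fin r) : Dhom k (cgen R r j) = Dmat k j :=
  clift_cgen _ _ _ _

lemma Dhom_tri (k : Fin (r - 1)) (a : CA R r) : Dhom k a 0 0 = a ∧ Dhom k a 1 0 = 0 := by
  have ha : a ∈ Algebra.adjoin R (Set.range (cgen R r)) := by
    rw [cgen_adjoin]; trivial
  induction ha using Algebra.adjoin_induction with
  | mem x hx =>
    obtain ⟨j, rfl⟩ := hx
    rw [Dhom_c]; simp [Dmat]
  | algebraMap x => rw [AlgHom.commutes]; simp [Matrix.algebraMap_matrix_apply]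
  | add x y _ _ hx hy => simp [map_add, hx, hy]
  | mul x y _ _ hx hy => simp [map_mul, Matrix.mul_apply, Fin.sum_univ_two, hx, hy]

noncomputable def theData : CData R r (CA R r) where
  c := cgen R r
  gen := cgen_adjoin R r
  csq := cgen_sq R r
  canti := cgen_anti R r
  σ k := Matrix.entryLinearMap R (CA R r) 1 1 ∘ₗ (Dhom k).toLinearMap
  δ k := Matrix.entryLinearMap R (CA R r) 0 1 ∘ₗ (Dhom k).toLinearMap
  σ_one k := by simp
  δ_one k := by simp
  σ_mul k a b := by
    simp [Matrix.mul_apply, Fin.sum_univ_two, (Dhom_tri k a).2]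
  δ_mul k a b := by
    simp [Matrix.mul_apply, Fin.sum_univ_two, (Dhom_tri k a).1]
  σ_c k j := by simp [Dhom_c, Dmat]
  δ_c k j := by simp [Dhom_c, Dmat, dval]

end Clif

end HCPaper
namespace HCPaper

section Ops

open MulOpposite

variable {R : Type} [CommRing R] {r : ℕ} {A : Type} [Ring A] [Algebra R A]

/-- right multiplication by `T_k` on the regular module -/
def rOp (q : R) (A : Type) [Ring A] [Algebra R A] (k : Fin (r - 1)) :
    (Equiv.Perm (Fin r) → A) →ₗ[R] (Equiv.Perm (Fin r) → A) where
  toFun m := fun w => if w (loIdx k) < w (hiIdx k) then q • m (w * simpleT k)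
    else m (w * simpleT k) + (q - 1) • m w
  map_add' m m' := by
    funext w
    simp only [Pi.add_apply]
    split_ifs <;> module
  map_smul' a m := by
    funext w
    simp only [Pi.smul_apply, RingHom.id_apply]
    split_ifs <;> module

/-- left multiplication by `T_k` on the regular module -/
def lOp (q : R) (A : Type) [Ring A] [Algebra R A] (k : Fin (r - 1)) :
    (Equiv.Perm (Fin r) → A) →ₗ[R] (Equiv.Perm (Fin r) → A) where
  toFun m := fun w => if w⁻¹ (loIdx k) < w⁻¹ (hiIdx k) then q • m (simpleT k * w)
    else m (simpleT k * w) + (q - 1) • m w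
  map_add' m m' := by
    funext w
    simp only [Pi.add_apply]
    split_ifs <;> module
  map_smul' a m := by
    funext w
    simp only [Pi.smul_apply, RingHom.id_apply]
    split_ifs <;> module

lemma rOp_apply (q : R) (k : Fin (r - 1)) (m : Equiv.Perm (Fin r) → A) (w) :
    rOp q A k m w = if w (loIdx k) < w (hiIdx k) then q • m (w * simpleT k)
    else m (w * simpleT k) + (q - 1) • m w := rfl

lemma lOp_apply (q : R) (k : Fin (r - 1)) (m : Equiv.Perm (Fin r) → A) (w) :
    lOp q A k m w = if w⁻¹ (loIdx k) < w⁻¹ (hiIdx k) then q • m (simpleT k * w)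
    else m (simpleT k * w) + (q - 1) • m w := rfl

lemma lt_hi_lo_iff (w : Equiv.Perm (Fin r)) (k : Fin (r - 1)) :
    w (hiIdx k) < w (loIdx k) ↔ ¬ w (loIdx k) < w (hiIdx k) := by
  have : w (loIdx k) ≠ w (hiIdx k) := fun h => (lo_lt_hi k).ne (w.injective h)
  constructor
  · exact fun h => h.asymm
  · intro h; exact lt_of_le_of_ne (not_lt.1 h) this.symm

/-- the order criterion under multiplication on the other side -/
lemma asc_other (w : Equiv.Perm (Fin r)) (k j : Fin (r - 1)) (h : simpleT k * w ≠ w * simpleT j) :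
    ((simpleT k * w) (loIdx j) < (simpleT k * w) (hiIdx j)) ↔ (w (loIdx j) < w (hiIdx j)) := by
  have hmain : ∀ x y : Fin r, (x = loIdx j ∧ y = hiIdx j ∨ x = hiIdx j ∧ y = loIdx j) → w x < w y →
      simpleT k (w x) < simpleT k (w y) := by
    intro x y hxy hlt
    apply simpleT_lt k hlt
    rintro ⟨h1, h2⟩
    apply h
    have : w * Equiv.swap x y * w⁻¹ = Equiv.swap (w x) (w y) := by
      exact (Equiv.swap_apply_apply w x y).symm
    have hs : Equiv.swap x y = simpleT j := by
      rcases hxy with ⟨rfl, rfl⟩ | ⟨rfl, rfl⟩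
      · rfl
      · exact Equiv.swap_comm _ _
    rw [hs, h1, h2] at this
    change _ = simpleT k at this
    rw [← this]; group
  constructor
  · intro hlt
    by_contra hcon
    rw [← lt_hi_lo_iff] at hcon
    exact absurd hlt (hmain _ _ (Or.inr ⟨rfl, rfl⟩) hcon).asymm
  · exact hmain _ _ (Or.inl ⟨rfl, rfl⟩)

lemma asc_other' (w : Equiv.Perm (Fin r)) (k j : Fin (r - 1)) (h : simpleT k * w ≠ w * simpleT j) :
    ((w * simpleT j)⁻¹ (loIdx k) < (w * simpleT j)⁻¹ (hiIdx k))
      ↔ (w⁻¹ (loIdx k) < w⁻¹ (hiIdx k)) := by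
  rw [mul_inv_rev, simpleT_inv]
  apply asc_other
  intro h2
  apply h
  have := congrArg (fun x => w * x * w) h2
  simpa [mul_assoc] using this.symm

lemma asc_right (w : Equiv.Perm (Fin r)) (j : Fin (r - 1)) :
    ((w * simpleT j) (loIdx j) < (w * simpleT j) (hiIdx j)) ↔ ¬ (w (loIdx j) < w (hiIdx j)) := by
  rw [Equiv.Perm.mul_apply, Equiv.Perm.mul_apply, simpleT_lo, simpleT_hi, lt_hi_lo_iff]

lemma asc_left (w : Equiv.Perm (Fin r)) (j : Fin (r - 1)) :
    ((simpleT j * w)⁻¹ (loIdx j) < (simpleT j * w)⁻¹ (hiIdx j))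
      ↔ ¬ (w⁻¹ (loIdx j) < w⁻¹ (hiIdx j)) := by
  rw [mul_inv_rev, simpleT_inv, asc_right]

lemma lr_comm (q : R) (k j : Fin (r - 1)) (m : Equiv.Perm (Fin r) → A) :
    lOp q A k (rOp q A j m) = rOp q A j (lOp q A k m) := by
  funext w
  by_cases h : simpleT k * w = w * simpleT j
  · have h3 : w⁻¹ * simpleT k = simpleT j * w⁻¹ := by
      have := congrArg (fun x => w⁻¹ * x * w⁻¹) h
      simpa [mul_assoc] using this
    have e1 : simpleT k * w * simpleT j = w := by rw [h, mul_assoc, simpleT_sq, mul_one]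
    have e2 : simpleT k * (w * simpleT j) = w := by rw [← mul_assoc, e1]
    have hL := asc_left w k
    have hR := asc_right w j
    have hab : (w⁻¹ (loIdx k) < w⁻¹ (hiIdx k)) ↔ (w (loIdx j) < w (hiIdx j)) := by
      have e3 : ∀ x, simpleT k (w x) = w (simpleT j x) := fun x => by
        have := congrArg (fun f : Equiv.Perm (Fin r) => f x) h; simpa using this
      have hsw : Equiv.swap (w (loIdx j)) (w (hiIdx j)) = simpleT k := by
        rw [Equiv.swap_apply_apply]
        change w * simpleT j * w⁻¹ = _
        rw [← h]; group
      have hne : w (loIdx j) ≠ w (hiIdx j) := fun h => (lo_lt_hi j).ne (w.injective h)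
      have h5 : simpleT k (w (loIdx j)) = w (hiIdx j) := by rw [← hsw]; simp
      by_cases hl : w (loIdx j) = loIdx k
      · have hh : w (hiIdx j) = hiIdx k := by rw [← h5, hl, simpleT_lo]
        rw [← hl, ← hh]
        simp only [Equiv.Perm.inv_def, Equiv.symm_apply_apply]
        rw [hl, hh]
        exact ⟨fun _ => lo_lt_hi k, fun _ => lo_lt_hi j⟩
      · by_cases hl2 : w (loIdx j) = hiIdx k
        · have hh : w (hiIdx j) = loIdx k := by rw [← h5, hl2, simpleT_hi]
          rw [← hl2, ← hh]
          simp only [Equiv.Perm.inv_def, Equiv.symm_apply_apply]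
          rw [hl2, hh]
          exact ⟨fun h => absurd h (lo_lt_hi j).asymm, fun h => absurd h (lo_lt_hi k).asymm⟩
        · exact absurd (by rw [← h5, simpleT_other k hl hl2]) hne
    rw [lOp_apply, rOp_apply, rOp_apply, rOp_apply, lOp_apply, lOp_apply]
    rw [e1, e2]
    rw [← h] at hR ⊢
    rw [if_congr hR rfl rfl, if_congr hL rfl rfl, if_congr hab rfl rfl]
    by_cases hw : w (loIdx j) < w (hiIdx j)
    · simp only [hab, hw, not_true, if_true, if_false]
    · simp only [hab, hw, not_false_iff, if_true, if_false]
  · have hR := asc_other w k j h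
    have hL := asc_other' w k j h
    rw [lOp_apply, rOp_apply, rOp_apply, rOp_apply, lOp_apply, lOp_apply]
    rw [if_congr hR rfl rfl, if_congr hL rfl rfl, mul_assoc]
    split_ifs <;> module

lemma rOp_single_asc (q : R) (k : Fin (r - 1)) (w : Equiv.Perm (Fin r)) (a : A)
    (h : w (loIdx k) < w (hiIdx k)) :
    rOp q A k (Pi.single w a) = Pi.single (w * simpleT k) a := by
  funext v
  rw [rOp_apply]
  have hww : w * simpleT k ≠ w := fun e => by
    have := congrArg (fun f : Equiv.Perm (Fin r) => f (loIdx k)) e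
    simp only [Equiv.Perm.mul_apply, simpleT_lo] at this
    exact (lo_lt_hi k).ne (w.injective this).symm
  by_cases hv : v = w * simpleT k
  · subst hv
    rw [if_neg (by rw [asc_right]; exact not_not.2 h), ← desc_eq]
    simp [hww]
  · have hv2 : v * simpleT k ≠ w := fun e => hv (by rw [← e, ← desc_eq])
    by_cases hvw : v = w
    · subst hvw
      rw [if_pos h]
      simp [hww, hww.symm]
    · simp [hv, hv2, hvw]

lemma rOp_single_desc (q : R) (k : Fin (r - 1)) (w : Equiv.Perm (Fin r)) (a : A)
    (h : ¬ w (loIdx k) < w (hiIdx k)) :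
    rOp q A k (Pi.single w a) = q • (Pi.single (w * simpleT k) a : Equiv.Perm (Fin r) → A)
      + (q - 1) • (Pi.single w a : Equiv.Perm (Fin r) → A) := by
  funext v
  rw [rOp_apply]
  have hww : w * simpleT k ≠ w := fun e => by
    have := congrArg (fun f : Equiv.Perm (Fin r) => f (loIdx k)) e
    simp only [Equiv.Perm.mul_apply, simpleT_lo] at this
    exact (lo_lt_hi k).ne (w.injective this).symm
  by_cases hv : v = w * simpleT k
  · subst hv
    rw [if_pos (by rw [asc_right]; exact h), ← desc_eq]
    simp [hww]
  · have hv2 : v * simpleT k ≠ w := fun e => hv (by rw [← e, ← desc_eq])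
    by_cases hvw : v = w
    · subst hvw
      rw [if_neg h]
      simp [hww, hww.symm]
    · simp [hv, hv2, hvw]

lemma lOp_single_asc (q : R) (k : Fin (r - 1)) (w : Equiv.Perm (Fin r)) (a : A)
    (h : w⁻¹ (loIdx k) < w⁻¹ (hiIdx k)) :
    lOp q A k (Pi.single w a) = Pi.single (simpleT k * w) a := by
  have h1 := rOp_single_asc q k w⁻¹ a h
  funext v
  have h2 := congrFun h1 v⁻¹
  rw [rOp_apply] at h2
  rw [lOp_apply]
  have e : ∀ u v : Equiv.Perm (Fin r), (Pi.single u⁻¹ a : Equiv.Perm (Fin r) → A) v⁻¹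
      = (Pi.single u a : Equiv.Perm (Fin r) → A) v := by
    intro u v
    simp only [Pi.single_apply, inv_inj]
  have e1 : v⁻¹ * simpleT k = (simpleT k * v)⁻¹ := by rw [mul_inv_rev, simpleT_inv]
  have e2 : w⁻¹ * simpleT k = (simpleT k * w)⁻¹ := by rw [mul_inv_rev, simpleT_inv]
  rw [e1, e2, e, e, e] at h2
  exact h2

end Ops

end HCPaper
namespace HCPaper

set_option linter.unusedSimpArgs false
set_option linter.unusedVariables false

section Abs

variable {R : Type} [CommRing R] {E : Type} [Ring E] [Algebra R E]

lemma assoc_of {x y z : E} (h : x * y = z) (t : E) : x * (y * t) = z * t := by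
  rw [← mul_assoc, h]

lemma abs_quad_lo (q : R) (T c1 c2 : E)
    (h1 : c1 * T = T * c2 + (q - 1) • (c1 - c2)) (h2 : c2 * T = T * c1) :
    c1 * (T * T - (q - 1) • T - q • 1) = (T * T - (q - 1) • T - q • 1) * c1 := by
  simp only [mul_add, add_mul, mul_sub, sub_mul, mul_assoc, assoc_of h1, assoc_of h2, h1, h2,
    smul_mul_assoc, mul_smul_comm, mul_one, one_mul]
  module

lemma abs_quad_hi (q : R) (T c1 c2 : E)
    (h1 : c1 * T = T * c2 + (q - 1) • (c1 - c2)) (h2 : c2 * T = T * c1) :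
    c2 * (T * T - (q - 1) • T - q • 1) = (T * T - (q - 1) • T - q • 1) * c2 := by
  simp only [mul_add, add_mul, mul_sub, sub_mul, mul_assoc, assoc_of h1, assoc_of h2, h1, h2,
    smul_mul_assoc, mul_smul_comm, mul_one, one_mul]
  module

lemma abs_braid1 (q : R) (T1 T2 c1 c2 c3 : E)
    (t1 : T1 * T1 = (q - 1) • T1 + q • 1) (t2 : T2 * T2 = (q - 1) • T2 + q • 1)
    (h1 : c1 * T1 = T1 * c2 + (q - 1) • (c1 - c2)) (h2 : c2 * T1 = T1 * c1)
    (h3 : c3 * T1 = T1 * c3)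
    (g1 : c1 * T2 = T2 * c1)
    (g2 : c2 * T2 = T2 * c3 + (q - 1) • (c2 - c3)) (g3 : c3 * T2 = T2 * c2) :
    c1 * (T1 * T2 * T1 - T2 * T1 * T2) = (T1 * T2 * T1 - T2 * T1 * T2) * c3 := by
  simp only [mul_add, add_mul, mul_sub, sub_mul, mul_assoc, assoc_of h1, assoc_of h2, assoc_of h3,
    assoc_of g1, assoc_of g2, assoc_of g3, h1, h2, h3, g1, g2, g3, t1, t2, assoc_of t1, assoc_of t2,
    smul_mul_assoc, mul_smul_comm, mul_one, one_mul]
  module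

lemma abs_braid2 (q : R) (T1 T2 c1 c2 c3 : E)
    (t1 : T1 * T1 = (q - 1) • T1 + q • 1) (t2 : T2 * T2 = (q - 1) • T2 + q • 1)
    (h1 : c1 * T1 = T1 * c2 + (q - 1) • (c1 - c2)) (h2 : c2 * T1 = T1 * c1)
    (h3 : c3 * T1 = T1 * c3)
    (g1 : c1 * T2 = T2 * c1)
    (g2 : c2 * T2 = T2 * c3 + (q - 1) • (c2 - c3)) (g3 : c3 * T2 = T2 * c2) :
    c2 * (T1 * T2 * T1 - T2 * T1 * T2) = (T1 * T2 * T1 - T2 * T1 * T2) * c2 := by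
  simp only [mul_add, add_mul, mul_sub, sub_mul, mul_assoc, assoc_of h1, assoc_of h2, assoc_of h3,
    assoc_of g1, assoc_of g2, assoc_of g3, h1, h2, h3, g1, g2, g3, t1, t2, assoc_of t1, assoc_of t2,
    smul_mul_assoc, mul_smul_comm, mul_one, one_mul]
  module

lemma abs_braid3 (q : R) (T1 T2 c1 c2 c3 : E)
    (t1 : T1 * T1 = (q - 1) • T1 + q • 1) (t2 : T2 * T2 = (q - 1) • T2 + q • 1)
    (h1 : c1 * T1 = T1 * c2 + (q - 1) • (c1 - c2)) (h2 : c2 * T1 = T1 * c1)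
    (h3 : c3 * T1 = T1 * c3)
    (g1 : c1 * T2 = T2 * c1)
    (g2 : c2 * T2 = T2 * c3 + (q - 1) • (c2 - c3)) (g3 : c3 * T2 = T2 * c2) :
    c3 * (T1 * T2 * T1 - T2 * T1 * T2) = (T1 * T2 * T1 - T2 * T1 * T2) * c1 := by
  simp only [mul_add, add_mul, mul_sub, sub_mul, mul_assoc, assoc_of h1, assoc_of h2, assoc_of h3,
    assoc_of g1, assoc_of g2, assoc_of g3, h1, h2, h3, g1, g2, g3, t1, t2, assoc_of t1, assoc_of t2,
    smul_mul_assoc, mul_smul_comm, mul_one, one_mul]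

/-- far commutation: `T2` commutes with `c1,c2` -/
lemma abs_comm_lo (q : R) (T1 T2 c1 c2 : E)
    (h1 : c1 * T1 = T1 * c2 + (q - 1) • (c1 - c2))
    (g1 : c1 * T2 = T2 * c1) (g2 : c2 * T2 = T2 * c2) :
    c1 * (T1 * T2 - T2 * T1) = (T1 * T2 - T2 * T1) * c2 := by
  simp only [mul_add, add_mul, mul_sub, sub_mul, mul_assoc, assoc_of h1,
    assoc_of g1, assoc_of g2, h1, g1, g2,
    smul_mul_assoc, mul_smul_comm, mul_one, one_mul]
  module

lemma abs_comm_gen (T1 T2 c c' : E)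
    (h1 : c * T1 = T1 * c') (g1 : c * T2 = T2 * c) (g2 : c' * T2 = T2 * c') :
    c * (T1 * T2 - T2 * T1) = (T1 * T2 - T2 * T1) * c' := by
  simp only [mul_sub, sub_mul, mul_assoc, assoc_of h1,
    assoc_of g1, assoc_of g2, h1, g1, g2]

lemma abs_flip {a b c c' : E} (h : c * (a - b) = (a - b) * c') : c * (b - a) = (b - a) * c' := by
  rw [← neg_sub, mul_neg, h, neg_mul]

end Abs

section Rep

open MulOpposite

variable {R : Type} [CommRing R] {r : ℕ} {A : Type} [Ring A] [Algebra R A]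

abbrev Mod (r : ℕ) (A : Type) := Equiv.Perm (Fin r) → A

/-- right action of `c_j` -/
def cOp (D : CData R r A) (j : Fin r) : Mod r A →ₗ[R] Mod r A where
  toFun m := fun w => m w * D.c j
  map_add' m m' := by funext w; simp [add_mul]
  map_smul' a m := by funext w; simp

/-- right action of `T_k` -/
def tOp (D : CData R r A) (q : R) (k : Fin (r - 1)) : Mod r A →ₗ[R] Mod r A :=
  rOp q A k ∘ₗ (D.σ k).compLeft _ + (q - 1) • (D.δ k).compLeft _

lemma tOp_apply (D : CData R r A) (q : R) (k : Fin (r - 1)) (m : Mod r A) :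
    tOp D q k m = rOp q A k (fun w => D.σ k (m w)) + (q - 1) • (fun w => D.δ k (m w)) := rfl

lemma tOp_cOp (D : CData R r A) (q : R) (k : Fin (r - 1)) (j : Fin r) (m : Mod r A) :
    tOp D q k (cOp D j m) = cOp D (simpleT k j) (tOp D q k m) +
      (q - 1) • (if j = loIdx k then cOp D (loIdx k) m - cOp D (hiIdx k) m else 0) := by
  funext w
  have e : ∀ (m : Mod r A) i w, cOp D i m w = m w * D.c i := fun _ _ _ => rfl
  rw [tOp_apply, tOp_apply]
  simp only [Pi.add_apply, Pi.smul_apply, rOp_apply, e, D.σ_mul, D.δ_mul, D.σ_c, D.δ_c]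
  by_cases hj : j = loIdx k
  · simp only [hj, if_true, Pi.sub_apply, e, mul_sub]
    split_ifs <;> simp only [add_mul, smul_mul_assoc] <;> module
  · simp only [hj, if_false, Pi.zero_apply]
    split_ifs <;> simp only [add_mul, smul_mul_assoc, mul_zero] <;> module

lemma lOp_tOp (D : CData R r A) (q : R) (k j : Fin (r - 1)) (m : Mod r A) :
    lOp q A k (tOp D q j m) = tOp D q j (lOp q A k m) := by
  rw [tOp_apply, tOp_apply, map_add, map_smul, lr_comm]
  congr 2
  · congr 1
    funext w
    simp only [lOp_apply]
    split_ifs <;> simp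
  · funext w
    simp only [lOp_apply]
    split_ifs <;> simp

lemma lOp_cOp (D : CData R r A) (q : R) (k : Fin (r - 1)) (j : Fin r) (m : Mod r A) :
    lOp q A k (cOp D j m) = cOp D j (lOp q A k m) := by
  funext w
  have e : ∀ (m : Mod r A) i w, cOp D i m w = m w * D.c i := fun _ _ _ => rfl
  simp only [lOp_apply, e]
  split_ifs <;> simp [add_mul]

def eVec (r : ℕ) (A : Type) [Ring A] : Mod r A := Pi.single 1 1

lemma single_mem (q : R) (N : Submodule R (Mod r A))
    (he : eVec r A ∈ N) (hL : ∀ k m, m ∈ N → lOp q A k m ∈ N) (w : Equiv.Perm (Fin r)) :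
    (Pi.single w 1 : Mod r A) ∈ N := by
  have : ∀ w : Equiv.Perm (Fin r), (Pi.single w⁻¹ 1 : Mod r A) ∈ N := by
    refine perm_induct (by rw [inv_one]; exact he) ?_
    intro w k h hw
    have := hL k _ hw
    rw [lOp_single_asc q k _ _ (by simpa using h)] at this
    rwa [mul_inv_rev, simpleT_inv]
  simpa using this w⁻¹

lemma sub_top (D : CData R r A) (q : R) (N : Submodule R (Mod r A))
    (he : eVec r A ∈ N) (hL : ∀ k m, m ∈ N → lOp q A k m ∈ N)
    (hC : ∀ j m, m ∈ N → cOp D j m ∈ N) (m : Mod r A) : m ∈ N := by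
  have hA : ∀ a : A, ∀ m ∈ N, (fun w => m w * a) ∈ N := by
    intro a
    have ha : a ∈ Algebra.adjoin R (Set.range D.c) := by rw [D.gen]; trivial
    induction ha using Algebra.adjoin_induction with
    | mem x hx =>
      obtain ⟨j, rfl⟩ := hx
      exact fun m hm => hC j m hm
    | algebraMap x =>
      intro m hm
      have : (fun w => m w * algebraMap R A x) = x • m := by
        funext w
        rw [Pi.smul_apply, Algebra.smul_def, Algebra.commutes]
      rw [this]; exact N.smul_mem x hm
    | add x y _ _ hx hy =>
      intro m hm
      simp only [mul_add]
      exact N.add_mem (hx m hm) (hy m hm)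
    | mul x y _ _ hx hy =>
      intro m hm
      simp only [← mul_assoc]
      exact hy _ (hx m hm)
  have : m = ∑ w, (fun v => (Pi.single w 1 : Mod r A) v * m w) := by
    funext v
    rw [Finset.sum_apply, Finset.sum_eq_single v]
    · simp
    · intro b _ hb; simp [Pi.single_apply, hb.symm]
    · simp
  rw [this]
  exact N.sum_mem fun w _ => hA _ _ (single_mem q N he hL w)

abbrev EndOp (R : Type) [CommRing R] (r : ℕ) (A : Type) [Ring A] [Algebra R A] :=
  (Module.End R (Mod r A))ᵐᵒᵖ

lemma op_zero (D : CData R r A) (q : R) (X : EndOp R r A)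
    (hL : ∀ k, Commute (op (lOp q A k) : EndOp R r A) X)
    (hC : ∀ j, ∃ j', (op (cOp D j) : EndOp R r A) * X = X * op (cOp D j'))
    (he : X.unop (eVec r A) = 0) : X = 0 := by
  apply unop_injective
  refine LinearMap.ext fun m => ?_
  change X.unop m = 0
  refine sub_top D q (LinearMap.ker X.unop) he ?_ ?_ m
  · intro k m hm
    have := congrArg (fun Y : EndOp R r A => Y.unop m) (hL k).eq
    change X.unop (lOp q A k m) = lOp q A k (X.unop m) at this
    rw [LinearMap.mem_ker] at hm ⊢
    rw [this, hm, map_zero]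
  · intro j m hm
    obtain ⟨j', h⟩ := hC j
    have := congrArg (fun Y : EndOp R r A => Y.unop m) h
    change X.unop (cOp D j m) = cOp D j' (X.unop m) at this
    rw [LinearMap.mem_ker] at hm ⊢
    rw [this, hm, map_zero]

variable (D : CData R r A) (q : R)

def opT (k : Fin (r - 1)) : EndOp R r A := op (tOp D q k)
def opC (j : Fin r) : EndOp R r A := op (cOp D j)

lemma opL_T (k j : Fin (r - 1)) : Commute (op (lOp q A k) : EndOp R r A) (opT D q j) := by
  apply unop_injective
  refine LinearMap.ext fun m => ?_
  exact (lOp_tOp D q k j m).symm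

lemma opC_T (k : Fin (r - 1)) (j : Fin r) : opC D j * opT D q k = opT D q k * opC D (simpleT k j) +
      (q - 1) • (if j = loIdx k then opC D (loIdx k) - opC D (hiIdx k) else 0) := by
  apply unop_injective
  refine LinearMap.ext fun m => ?_
  refine (tOp_cOp D q k j m).trans ?_
  split_ifs <;> rfl

lemma opC_T_lo (k : Fin (r - 1)) : opC D (loIdx k) * opT D q k = opT D q k * opC D (hiIdx k) +
      (q - 1) • (opC D (loIdx k) - opC D (hiIdx k)) := by
  rw [opC_T, simpleT_lo, if_pos rfl]

lemma opC_T_hi (k : Fin (r - 1)) : opC D (hiIdx k) * opT D q k = opT D q k * opC D (loIdx k) := by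
  rw [opC_T, simpleT_hi, if_neg (lo_lt_hi k).ne', smul_zero, add_zero]

lemma opC_T_other (k : Fin (r - 1)) (j : Fin r) (h1 : j ≠ loIdx k) (h2 : j ≠ hiIdx k) :
    opC D j * opT D q k = opT D q k * opC D j := by
  rw [opC_T, simpleT_other k h1 h2, if_neg h1, smul_zero, add_zero]

lemma tOp_single_one (k : Fin (r - 1)) (w : Equiv.Perm (Fin r)) :
    tOp D q k (Pi.single w 1) = rOp q A k (Pi.single w 1) := by
  rw [tOp_apply]
  have h1 : (fun v => D.σ k ((Pi.single w 1 : Mod r A) v)) = Pi.single w 1 := by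
    funext v
    by_cases h : v = w
    · subst h; simp [D.σ_one]
    · simp [h]
  have h2 : (fun v => D.δ k ((Pi.single w 1 : Mod r A) v)) = 0 := by
    funext v
    by_cases h : v = w
    · subst h; simp [D.δ_one]
    · simp [h]
  rw [h1, h2, smul_zero, add_zero]

lemma tOp_single_asc (k : Fin (r - 1)) (w : Equiv.Perm (Fin r)) (h : w (loIdx k) < w (hiIdx k)) :
    tOp D q k (Pi.single w 1) = Pi.single (w * simpleT k) 1 := by
  rw [tOp_single_one, rOp_single_asc q k w 1 h]

lemma opT_quad (k : Fin (r - 1)) : opT D q k * opT D q k = (q - 1) • opT D q k + q • 1 := by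
  have : opT D q k * opT D q k - (q - 1) • opT D q k - q • 1 = 0 := by
    apply op_zero D q
    · intro j
      have hT := opL_T D q j k
      exact ((hT.mul_right hT).sub_right (hT.smul_right _)).sub_right
        ((Commute.one_right _).smul_right _)
    · intro j
      refine ⟨j, ?_⟩
      change opC D j * _ = _ * opC D j
      by_cases h1 : j = loIdx k
      · subst h1
        exact abs_quad_lo q _ _ _ (opC_T_lo D q k) (opC_T_hi D q k)
      · by_cases h2 : j = hiIdx k
        · subst h2
          exact abs_quad_hi q _ _ _ (opC_T_lo D q k) (opC_T_hi D q k)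
        · have h := opC_T_other D q k j h1 h2
          simp only [mul_sub, sub_mul, mul_assoc, assoc_of h, h,
            smul_mul_assoc, mul_smul_comm, mul_one, one_mul]
    · change tOp D q k (tOp D q k (eVec r A)) - (q - 1) • tOp D q k (eVec r A) - q • eVec r A = 0
      rw [eVec, tOp_single_asc D q k 1 (by simpa using lo_lt_hi k), tOp_single_one,
        rOp_single_desc q k _ _ (by rw [asc_right]; simpa using lo_lt_hi k), ← desc_eq]
      abel
  rw [sub_sub, sub_eq_zero] at this
  exact this

lemma idx_ne {a b : Fin r} (h : a.val ≠ b.val) : a ≠ b := fun e => h (congrArg Fin.val e)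

lemma asc_one_mul (i j : Fin (r - 1)) (h : i ≠ j) :
    (1 * simpleT i : Equiv.Perm (Fin r)) (loIdx j)
      < (1 * simpleT i : Equiv.Perm (Fin r)) (hiIdx j) := by
  rw [one_mul]
  apply simpleT_lt i (lo_lt_hi j)
  rintro ⟨h1, h2⟩
  have h3 : j.val = i.val := by simpa [loIdx] using h1
  exact h (Fin.ext h3.symm)

lemma opT_comm (i j : Fin (r - 1)) (hij : i.val + 1 < j.val) :
    opT D q i * opT D q j = opT D q j * opT D q i := by
  have n1 : loIdx i ≠ loIdx j := idx_ne (by simp [loIdx]; omega)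
  have n2 : loIdx i ≠ hiIdx j := idx_ne (by simp [loIdx, hiIdx]; omega)
  have n3 : hiIdx i ≠ loIdx j := idx_ne (by simp [loIdx, hiIdx]; omega)
  have n4 : hiIdx i ≠ hiIdx j := idx_ne (by simp [hiIdx]; omega)
  have nij : i ≠ j := fun e => by subst e; omega
  rw [← sub_eq_zero]
  apply op_zero D q
  · intro k
    have hi := opL_T D q k i
    have hj := opL_T D q k j
    exact (hi.mul_right hj).sub_right (hj.mul_right hi)
  · intro c
    change ∃ c', opC D c * _ = _ * opC D c'
    by_cases h1 : c = loIdx i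
    · subst h1
      exact ⟨_, abs_comm_lo q _ _ _ _ (opC_T_lo D q i) (opC_T_other D q j _ n1 n2)
        (opC_T_other D q j _ n3 n4)⟩
    by_cases h2 : c = hiIdx i
    · subst h2
      exact ⟨_, abs_comm_gen _ _ _ _ (opC_T_hi D q i) (opC_T_other D q j _ n3 n4)
        (opC_T_other D q j _ n1 n2)⟩
    have hi := opC_T_other D q i c h1 h2
    by_cases h3 : c = loIdx j
    · subst h3
      refine ⟨hiIdx j, ?_⟩
      have := abs_comm_lo q _ _ _ _ (opC_T_lo D q j) (opC_T_other D q i _ n1.symm n3.symm)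
        (opC_T_other D q i _ n2.symm n4.symm)
      exact abs_flip this
    by_cases h4 : c = hiIdx j
    · subst h4
      refine ⟨loIdx j, ?_⟩
      have := abs_comm_gen _ _ _ _ (opC_T_hi D q j) (opC_T_other D q i _ n2.symm n4.symm)
        (opC_T_other D q i _ n1.symm n3.symm)
      exact abs_flip this
    have hj := opC_T_other D q j c h3 h4
    exact ⟨c, abs_comm_gen _ _ _ _ hi hj hj⟩
  · change tOp D q j (tOp D q i (eVec r A)) - tOp D q i (tOp D q j (eVec r A)) = 0
    rw [eVec, tOp_single_asc D q i 1 (by simpa using lo_lt_hi i),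
      tOp_single_asc D q j 1 (by simpa using lo_lt_hi j),
      tOp_single_asc D q j _ (asc_one_mul i j nij), tOp_single_asc D q i _ (asc_one_mul j i nij.symm)]
    have : (simpleT i * simpleT j : Equiv.Perm (Fin r)) = simpleT j * simpleT i := by
      apply Equiv.Perm.Disjoint.commute
      intro x
      by_cases h1 : x = loIdx i
      · right; rw [h1]; exact simpleT_other j n1 n2
      by_cases h2 : x = hiIdx i
      · right; rw [h2]; exact simpleT_other j n3 n4
      left; exact simpleT_other i h1 h2
    rw [one_mul, one_mul, this, sub_self]

lemma opT_braid (i j : Fin (r - 1)) (hij : j.val = i.val + 1) :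
    opT D q i * opT D q j * opT D q i = opT D q j * opT D q i * opT D q j := by
  have e2 : loIdx j = hiIdx i := Fin.ext hij
  have n1 : loIdx i ≠ loIdx j := idx_ne (by simp [loIdx]; omega)
  have n2 : loIdx i ≠ hiIdx j := idx_ne (by simp [loIdx, hiIdx]; omega)
  have n4 : hiIdx i ≠ hiIdx j := idx_ne (by simp [hiIdx]; omega)
  have nij : i ≠ j := fun e => by subst e; omega
  have t1 := opT_quad D q i
  have t2 := opT_quad D q j
  have a1 := opC_T_lo D q i
  have a2 := opC_T_hi D q i
  have a3 := opC_T_other D q i (hiIdx j) n2.symm n4.symm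
  have b1 := opC_T_other D q j (loIdx i) n1 n2
  have b2 := opC_T_lo D q j
  have b3 := opC_T_hi D q j
  rw [e2] at b2 b3
  rw [← sub_eq_zero]
  apply op_zero D q
  · intro k
    have hi := opL_T D q k i
    have hj := opL_T D q k j
    exact ((hi.mul_right hj).mul_right hi).sub_right ((hj.mul_right hi).mul_right hj)
  · intro c
    change ∃ c', opC D c * _ = _ * opC D c'
    by_cases h1 : c = loIdx i
    · subst h1
      exact ⟨_, abs_braid1 q _ _ _ _ _ t1 t2 a1 a2 a3 b1 b2 b3⟩
    by_cases h2 : c = hiIdx i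
    · subst h2
      exact ⟨_, abs_braid2 q _ _ _ _ _ t1 t2 a1 a2 a3 b1 b2 b3⟩
    by_cases h3 : c = hiIdx j
    · subst h3
      exact ⟨_, abs_braid3 q _ _ _ _ _ t1 t2 a1 a2 a3 b1 b2 b3⟩
    have hi := opC_T_other D q i c h1 h2
    have hj := opC_T_other D q j c (by rwa [e2]) h3
    refine ⟨c, ?_⟩
    simp only [mul_sub, sub_mul, mul_assoc, assoc_of hi, assoc_of hj, hi, hj]
  · change tOp D q i (tOp D q j (tOp D q i (eVec r A)))
      - tOp D q j (tOp D q i (tOp D q j (eVec r A))) = 0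
    have m3 : hiIdx j ≠ loIdx i := n2.symm
    have s1 : simpleT i (loIdx i) = hiIdx i := simpleT_lo i
    have s2 : simpleT i (hiIdx i) = loIdx i := simpleT_hi i
    have s3 : simpleT i (hiIdx j) = hiIdx j := simpleT_other i n2.symm n4.symm
    have u1 : simpleT j (loIdx i) = loIdx i := simpleT_other j n1 n2
    have u2 : simpleT j (hiIdx i) = hiIdx j := by rw [← e2, simpleT_lo]
    have u3 : simpleT j (hiIdx j) = hiIdx i := by rw [← e2, simpleT_hi]
    rw [eVec, tOp_single_asc D q i 1 (by simpa using lo_lt_hi i),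
      tOp_single_asc D q j 1 (by simpa using lo_lt_hi j),
      tOp_single_asc D q j _ (asc_one_mul i j nij), tOp_single_asc D q i _ (asc_one_mul j i nij.symm),
      tOp_single_asc D q i, tOp_single_asc D q j]
    · have : (simpleT i * simpleT j * simpleT i : Equiv.Perm (Fin r))
          = simpleT j * simpleT i * simpleT j := by
        ext1 x
        simp only [Equiv.Perm.mul_apply]
        by_cases h1 : x = loIdx i
        · subst h1; simp only [s1, s2, s3, u1, u2, u3]
        by_cases h2 : x = hiIdx i
        · subst h2; simp only [s1, s2, s3, u1, u2, u3]
        by_cases h3 : x = hiIdx j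
        · subst h3; simp only [s1, s2, s3, u1, u2, u3]
        have v1 := simpleT_other i h1 h2
        have v2 := simpleT_other j (x := x) (by rwa [e2]) h3
        simp only [v1, v2]
      rw [one_mul, one_mul, this, sub_self]
    · simp only [one_mul, Equiv.Perm.mul_apply, e2, s1, s2, s3, u1, u2, u3]
      exact (lo_lt_hi i)
    · simp only [one_mul, Equiv.Perm.mul_apply, s1, s2, s3, u1, u2, u3]
      rw [← e2]; exact lo_lt_hi j

lemma opC_sq (j : Fin r) : opC D j * opC D j = -1 := by
  apply unop_injective
  refine LinearMap.ext fun m => ?_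
  funext w
  change m w * D.c j * D.c j = - m w
  rw [mul_assoc, D.csq, mul_neg, mul_one]

lemma opC_anti (i j : Fin r) (h : i ≠ j) : opC D i * opC D j = -(opC D j * opC D i) := by
  apply unop_injective
  refine LinearMap.ext fun m => ?_
  funext w
  change m w * D.c i * D.c j = - (m w * D.c j * D.c i)
  rw [mul_assoc, D.canti i j h, mul_neg, mul_assoc]

def repGen : Gen r → EndOp R r A
  | Sum.inl k => opT D q k
  | Sum.inr j => opC D j

noncomputable def rep : HC R q r →ₐ[R] EndOp R r A :=
  RingQuot.liftAlgHom R ⟨FreeAlgebra.lift R (repGen D q), by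
    have hT : ∀ k, FreeAlgebra.lift R (repGen D q) (Tf R r k) = opT D q k := fun k => by
      simp [Tf, repGen]
    have hC : ∀ k, FreeAlgebra.lift R (repGen D q) (Cf R r k) = opC D k := fun k => by
      simp [Cf, repGen]
    intro x y h
    cases h with
    | csq j => simp only [map_mul, map_neg, map_one, hC]; exact opC_sq D j
    | canti i j h => simp only [map_mul, map_neg, hC]; exact opC_anti D i j h
    | quad i =>
      simp only [map_mul, map_sub, map_add, map_one, map_zero, hT, AlgHom.commutes]
      rw [sub_mul, mul_add, opT_quad, ← Algebra.smul_def, mul_one]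
      module
    | commTT i i' h => simp only [map_mul, hT]; exact opT_comm D q i i' h
    | braid i i' h => simp only [map_mul, hT]; exact opT_braid D q i i' h
    | commTC i j h1 h2 =>
      simp only [map_mul, hT, hC]
      exact (opC_T_other D q i j (idx_ne h1) (idx_ne h2)).symm
    | TClo i =>
      simp only [map_mul, hT, hC]
      exact (opC_T_hi D q i).symm
    | TChi i =>
      simp only [map_mul, map_sub, hT, hC, AlgHom.commutes]
      rw [opC_T_lo, ← map_sub, ← Algebra.smul_def, add_sub_cancel_right]⟩

lemma rep_T (k : Fin (r - 1)) : rep D q (TT R q r k) = opT D q k := by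
  simp [rep, TT, Tf, repGen]

lemma rep_C (k : Fin r) : rep D q (CC R q r k) = opC D k := by
  simp [rep, CC, Cf, repGen]

end Rep

end HCPaper
namespace HCPaper

section Young

variable {r n : ℕ} (lam : Fin n → ℕ)

lemma psum_add_le {a b : Fin n} (h : a < b) : psum lam a + lam a ≤ psum lam b := by
  have h1 : lam a = ∑ i : Fin n, if i = a then lam i else 0 := by simp
  unfold psum
  rw [h1, ← Finset.sum_add_distrib]
  apply Finset.sum_le_sum
  intro i _
  rw [Fin.lt_def] at h
  by_cases hi : i = a
  · subst hi; simp [h]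
  · simp only [hi, if_false, add_zero]
    split_ifs <;> omega

lemma block_lt {a b : Fin n} {x y : Fin r} (hx : InBlock lam a x) (hy : InBlock lam b y)
    (h : a < b) : x < y := by
  have := psum_add_le lam h
  rw [Fin.lt_def]
  have h1 := hx.2
  have h2 := hy.1
  omega

lemma psum_succ (a : Fin n) : psum lam (a.val + 1) = psum lam a + lam a := by
  have h1 : lam a = ∑ i : Fin n, if i = a then lam i else 0 := by simp
  unfold psum
  rw [h1, ← Finset.sum_add_distrib]
  apply Finset.sum_congr rfl
  intro i _
  by_cases hi : i = a
  · subst hi; simp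
  · have : i.val ≠ a.val := fun e => hi (Fin.ext e)
    simp only [hi, if_false, add_zero]
    split_ifs <;> omega

lemma exists_block (hlam : ∑ i, lam i = r) (x : Fin r) : ∃ a, InBlock lam a x := by
  have hn : psum lam n = r := by simp [psum, hlam]
  have h0 : psum lam 0 = 0 := by simp [psum]
  have key : ∀ m, m ≤ n → x.val < psum lam m → ∃ a, InBlock lam a x := by
    intro m
    induction m with
    | zero => intro _ h; omega
    | succ m ih =>
      intro hm h
      by_cases h2 : x.val < psum lam m
      · exact ih (by omega) h2
      · have := psum_succ lam ⟨m, hm⟩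
        exact ⟨⟨m, hm⟩, by simpa using h2, by simpa [← this] using h⟩
  exact key n le_rfl (by rw [hn]; exact x.isLt)

lemma block_unique {a b : Fin n} {x : Fin r} (hx : InBlock lam a x) (hy : InBlock lam b x) :
    a = b := by
  rcases lt_trichotomy a b with h | h | h
  · exact absurd (block_lt lam hx hy h) (lt_irrefl _)
  · exact h
  · exact absurd (block_lt lam hy hx h) (lt_irrefl _)

lemma mem_simple {a : Fin n} {k : Fin (r - 1)} (h1 : InBlock lam a (loIdx k))
    (h2 : InBlock lam a (hiIdx k)) : MemYoung lam (simpleT k) := by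
  intro b j hj
  by_cases e1 : j = loIdx k
  · subst e1
    rw [simpleT_lo, block_unique lam hj h1]; exact h2
  by_cases e2 : j = hiIdx k
  · subst e2
    rw [simpleT_hi, block_unique lam hj h2]; exact h1
  rwa [simpleT_other k e1 e2]

/-- an element of the Young subgroup preserves the order of pairs in different blocks -/
lemma young_lt (hlam : ∑ i, lam i = r) {u : Equiv.Perm (Fin r)} (hu : MemYoung lam u) {x y : Fin r}
    (hxy : x < y) (hne : ∀ a, InBlock lam a x → ¬ InBlock lam a y) : u x < u y := by
  obtain ⟨a, ha⟩ := exists_block lam hlam x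
  obtain ⟨b, hb⟩ := exists_block lam hlam y
  rcases lt_trichotomy a b with h | h | h
  · exact block_lt lam (hu a x ha) (hu b y hb) h
  · subst h; exact absurd hb (hne a ha)
  · exact absurd (block_lt lam hb ha h) hxy.asymm

def youngSub (hlam : ∑ i, lam i = r) : Subgroup (Equiv.Perm (Fin r)) where
  carrier := {u | MemYoung lam u}
  one_mem' := fun _ _ h => h
  mul_mem' := fun {u v} hu hv a x hx => hu a _ (hv a x hx)
  inv_mem' := by
    intro u hu a x hx
    obtain ⟨b, hb⟩ := exists_block lam hlam (u⁻¹ x)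
    have h1 := hu b _ hb
    have h2 : u (u⁻¹ x) = x := by simp
    rw [h2] at h1
    rw [block_unique lam hx h1]
    exact hb

lemma mem_youngSub (hlam : ∑ i, lam i = r) (u : Equiv.Perm (Fin r)) :
    u ∈ youngSub lam hlam ↔ MemYoung lam u := Iff.rfl

lemma young_inv (hlam : ∑ i, lam i = r) {B : Type} (m : Equiv.Perm (Fin r) → B)
    (hm : ∀ k, MemYoung lam (simpleT k : Equiv.Perm (Fin r)) → ∀ w, m (simpleT k * w) = m w) :
    ∀ u, MemYoung lam u → ∀ w, m (u * w) = m w := by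
  have : ∀ l, ∀ u : Equiv.Perm (Fin r), len u = l → MemYoung lam u → ∀ w, m (u * w) = m w := by
    intro l
    induction l using Nat.strong_induction_on with
    | _ l ih =>
      intro u hl hu w
      by_cases hu1 : u = 1
      · rw [hu1, one_mul]
      · obtain ⟨k, hk⟩ := exists_desc u hu1
        have hs : MemYoung lam (simpleT k : Equiv.Perm (Fin r)) := by
          by_contra hcon
          refine absurd hk (young_lt lam hlam hu (lo_lt_hi k) ?_).asymm
          exact fun a h1 h2 => hcon (mem_simple lam h1 h2)
        have hlt := len_desc u k hk
        have h3 := ih _ (by omega) (u * simpleT k) rfl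
          ((youngSub lam hlam).mul_mem hu hs) (simpleT k * w)
        rw [← mul_assoc, ← desc_eq] at h3
        rw [h3, hm k hs]
  exact fun u => this _ u rfl

/-- `d` has minimal length in its coset `S_λ d` -/
def IsMin (d : Equiv.Perm (Fin r)) : Prop :=
  ∀ k, MemYoung lam (simpleT k : Equiv.Perm (Fin r)) → d⁻¹ (loIdx k) < d⁻¹ (hiIdx k)

lemma IsMin.lt {d : Equiv.Perm (Fin r)} (hd : IsMin lam d) {a : Fin n} :
    ∀ (x y : Fin r), InBlock lam a x → InBlock lam a y → x < y → d⁻¹ x < d⁻¹ y := by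
  have : ∀ (l : ℕ) (x y : Fin r), y.val = x.val + l + 1 → InBlock lam a x → InBlock lam a y →
      d⁻¹ x < d⁻¹ y := by
    intro l
    induction l with
    | zero =>
      intro x y hxy hx hy
      have hk : x.val < r - 1 := by have := y.isLt; omega
      have e1 : x = loIdx ⟨x.val, hk⟩ := rfl
      have e2 : y = hiIdx ⟨x.val, hk⟩ := Fin.ext hxy
      rw [e1] at hx
      rw [e2] at hy
      rw [e2]
      exact hd _ (mem_simple lam hx hy)
    | succ l ih =>
      intro x y hxy hx hy
      have hk : y.val - 1 < r - 1 := by have := y.isLt; omega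
      have e2 : y = hiIdx ⟨y.val - 1, hk⟩ := Fin.ext (by simp [hiIdx]; omega)
      have hz : InBlock lam a (loIdx ⟨y.val - 1, hk⟩) := by
        have h1 := hx.1
        have h2 := hy.2
        constructor
        · simp only [loIdx]; omega
        · simp only [loIdx]; omega
      have h1 := ih x (loIdx ⟨y.val - 1, hk⟩) (by simp only [loIdx]; omega) hx hz
      rw [e2] at hy
      have h2 := hd _ (mem_simple lam hz hy)
      rw [← e2] at h2
      exact h1.trans h2
  intro x y hx hy hxy
  exact this (y.val - x.val - 1) x y (by rw [Fin.lt_def] at hxy; omega) hx hy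

lemma exists_min (hlam : ∑ i, lam i = r) (w : Equiv.Perm (Fin r)) :
    ∃ u, MemYoung lam u ∧ IsMin lam (u * w) := by
  obtain ⟨u, hu, hmin⟩ := Finset.exists_min_image
    (Finset.univ.filter fun u : Equiv.Perm (Fin r) => MemYoung lam u)
    (fun u => len (u * w)⁻¹) ⟨1, by
      rw [Finset.mem_filter]; exact ⟨Finset.mem_univ _, (youngSub lam hlam).one_mem⟩⟩
  rw [Finset.mem_filter] at hu
  refine ⟨u, hu.2, ?_⟩
  intro k hk
  by_contra hcon
  rw [← lt_hi_lo_iff] at hcon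
  have h1 := len_desc _ k hcon
  have h2 := hmin (simpleT k * u) (by
    rw [Finset.mem_filter]; exact ⟨Finset.mem_univ _, (youngSub lam hlam).mul_mem hk hu.2⟩)
  simp only [mul_assoc, mul_inv_rev, simpleT_inv] at h1 h2
  omega

end Young

section Final

open MulOpposite

variable {R : Type} [CommRing R] {q : R} {r : ℕ}

lemma eq_of_smul {A : Type} [Ring A] [Algebra R A] (q : R) (x y : A) (h : x + (q - 1) • y = q • y) :
    x = y := by
  rw [sub_smul, one_smul] at h
  have h5 := sub_eq_zero.2 h
  rw [← sub_eq_zero, ← h5]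
  abel

lemma CC_sq (j : Fin r) : CC R q r j * CC R q r j = -1 := by
  have := RingQuot.mkAlgHom_rel R (HCRel.csq (R := R) (q := q) j)
  simpa [CC] using this

lemma CC_anti (i j : Fin r) (h : i ≠ j) : CC R q r i * CC R q r j = -(CC R q r j * CC R q r i) := by
  have := RingQuot.mkAlgHom_rel R (HCRel.canti (R := R) (q := q) i j h)
  simpa [CC] using this

lemma TT_quad (k : Fin (r - 1)) :
    TT R q r k * TT R q r k = (q - 1) • TT R q r k + q • 1 := by
  have := RingQuot.mkAlgHom_rel R (HCRel.quad (R := R) (q := q) k)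
  simp only [map_mul, map_sub, map_add, map_one, map_zero, AlgHom.commutes] at this
  change (TT R q r k - algebraMap R _ q) * (TT R q r k + 1) = 0 at this
  rw [sub_mul, mul_add, mul_one, ← Algebra.smul_def, sub_eq_zero] at this
  rw [eq_sub_of_add_eq this]
  module

lemma CC_TT (k : Fin (r - 1)) (j : Fin r) : CC R q r j * TT R q r k =
    TT R q r k * CC R q r (simpleT k j) +
      (q - 1) • (if j = loIdx k then CC R q r (loIdx k) - CC R q r (hiIdx k) else 0) := by
  by_cases h1 : j = loIdx k
  · subst h1
    have := RingQuot.mkAlgHom_rel R (HCRel.TChi (R := R) (q := q) k)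
    simp only [map_mul, map_sub, AlgHom.commutes] at this
    change TT R q r k * CC R q r (hiIdx k) = CC R q r (loIdx k) * TT R q r k -
      (algebraMap R _ q - algebraMap R _ 1) * (CC R q r (loIdx k) - CC R q r (hiIdx k)) at this
    rw [← map_sub, ← Algebra.smul_def] at this
    rw [simpleT_lo, if_pos rfl, this, sub_add_cancel]
  · rw [if_neg h1, smul_zero, add_zero]
    by_cases h2 : j = hiIdx k
    · subst h2
      have := RingQuot.mkAlgHom_rel R (HCRel.TClo (R := R) (q := q) k)
      simp only [map_mul] at this
      rw [simpleT_hi]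
      exact this.symm
    · rw [simpleT_other k h1 h2]
      have := RingQuot.mkAlgHom_rel R (HCRel.commTC (R := R) (q := q) k j
        (fun e => h1 (Fin.ext e)) (fun e => h2 (Fin.ext e)))
      simp only [map_mul] at this
      exact this.symm

lemma HC_induct {P : HC R q r → Prop} (halg : ∀ a, P (algebraMap R _ a))
    (hT : ∀ k, P (TT R q r k)) (hC : ∀ j, P (CC R q r j))
    (hadd : ∀ x y, P x → P y → P (x + y)) (hmul : ∀ x y, P x → P y → P (x * y)) : ∀ h, P h := by
  intro h
  obtain ⟨x, rfl⟩ := RingQuot.mkAlgHom_surjective R (HCRel R q r) h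
  induction x using FreeAlgebra.induction with
  | grade0 a => rw [AlgHom.commutes]; exact halg a
  | grade1 g =>
    cases g with
    | inl k => exact hT k
    | inr j => exact hC j
  | add x y hx hy => rw [map_add]; exact hadd _ _ hx hy
  | mul x y hx hy => rw [map_mul]; exact hmul _ _ hx hy

noncomputable def phi (R : Type) [CommRing R] (q : R) (r : ℕ) : CA R r →ₐ[R] HC R q r :=
  clift (CC R q r) CC_sq CC_anti

lemma phi_c (j : Fin r) : phi R q r (cgen R r j) = CC R q r j := clift_cgen _ _ _ _

lemma phi_T (k : Fin (r - 1)) (a : CA R r) : phi R q r a * TT R q r k =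
    TT R q r k * phi R q r (theData.σ k a) + (q - 1) • phi R q r (theData.δ k a) := by
  have ha : a ∈ Algebra.adjoin R (Set.range (cgen R r)) := by
    rw [cgen_adjoin]; trivial
  induction ha using Algebra.adjoin_induction with
  | mem x hx =>
    obtain ⟨j, rfl⟩ := hx
    have h1 := (theData (R := R) (r := r)).σ_c k j
    have h2 := (theData (R := R) (r := r)).δ_c k j
    change theData.σ k (cgen R r j) = cgen R r _ at h1
    change theData.δ k (cgen R r j) = if j = loIdx k then cgen R r _ - cgen R r _ else 0 at h2
    rw [h1, h2, phi_c, phi_c, CC_TT]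
    split_ifs <;> simp [phi_c]
  | algebraMap x =>
    rw [Algebra.algebraMap_eq_smul_one, map_smul, map_smul, map_smul, theData.σ_one,
      map_smul, theData.δ_one]
    simp
  | add x y _ _ hx hy =>
    simp only [map_add, add_mul, hx, hy, mul_add, smul_add]
    abel
  | mul x y _ _ hx hy =>
    rw [theData.σ_mul, theData.δ_mul]
    simp only [map_mul, map_add]
    rw [mul_assoc, hy, mul_add, ← mul_assoc, hx, add_mul, mul_smul_comm, smul_mul_assoc,
      smul_add, mul_assoc]
    abel

noncomputable def mu (TW : Equiv.Perm (Fin r) → HC R q r) : Mod r (CA R r) →ₗ[R] HC R q r :=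
  ∑ w, LinearMap.mulLeft R (TW w) ∘ₗ (phi R q r).toLinearMap ∘ₗ LinearMap.proj w

lemma mu_apply (TW : Equiv.Perm (Fin r) → HC R q r) (m : Mod r (CA R r)) :
    mu TW m = ∑ w, TW w * phi R q r (m w) := by
  simp [mu]

lemma mu_single (TW : Equiv.Perm (Fin r) → HC R q r) (w : Equiv.Perm (Fin r)) (a : CA R r) :
    mu TW (Pi.single w a) = TW w * phi R q r a := by
  rw [mu_apply, Finset.sum_eq_single w]
  · simp
  · intro b _ hb; simp [hb]
  · simp

variable {TW : Equiv.Perm (Fin r) → HC R q r}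


lemma TW_asc (hTW : IsTW q r TW) (w : Equiv.Perm (Fin r)) (k : Fin (r - 1)) (h : w (loIdx k) < w (hiIdx k)) :
    TW (w * simpleT k) = TW w * TT R q r k := hTW.2 w k (len_asc w k h)

lemma TW_desc (hTW : IsTW q r TW) (w : Equiv.Perm (Fin r)) (k : Fin (r - 1)) (h : ¬ w (loIdx k) < w (hiIdx k)) :
    TW w * TT R q r k = q • TW (w * simpleT k) + (q - 1) • TW w := by
  have h1 := TW_asc hTW (w * simpleT k) k (by rw [asc_right]; exact h)
  rw [← desc_eq] at h1
  rw [h1, mul_assoc, TT_quad, mul_add, mul_smul_comm, mul_smul_comm, mul_one]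
  abel

lemma mu_r (hTW : IsTW q r TW) (k : Fin (r - 1)) (m : Mod r (CA R r)) :
    mu TW (rOp q _ k m) = ∑ w, TW w * TT R q r k * phi R q r (m w) := by
  have h2 : mu (fun w => TW w * TT R q r k) m = ∑ w, TW w * TT R q r k * phi R q r (m w) :=
    mu_apply _ _
  rw [← h2]
  suffices h : mu TW ∘ₗ rOp q _ k = mu (fun w => TW w * TT R q r k) from
    congrArg (fun f => f m) h
  apply LinearMap.pi_ext
  intro w a
  rw [LinearMap.comp_apply, mu_single]
  by_cases h : w (loIdx k) < w (hiIdx k)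
  · rw [rOp_single_asc q k w a h, mu_single, TW_asc hTW w k h]
  · rw [rOp_single_desc q k w a h, map_add, map_smul, map_smul, mu_single, mu_single,
      TW_desc hTW w k h, add_mul, smul_mul_assoc, smul_mul_assoc]

lemma mu_act (hTW : IsTW q r TW) (h : HC R q r) : ∀ m, mu TW ((rep theData q h).unop m) = mu TW m * h := by
  induction h using HC_induct with
  | halg a =>
    intro m
    rw [AlgHom.commutes]
    change mu TW (a • m) = _
    rw [map_smul, Algebra.smul_def, Algebra.commutes]
  | hT k =>
    intro m
    rw [rep_T]
    change mu TW (tOp theData q k m) = _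
    rw [tOp_apply, map_add, map_smul, mu_r hTW, mu_apply, mu_apply, Finset.sum_mul,
      Finset.smul_sum, ← Finset.sum_add_distrib]
    apply Finset.sum_congr rfl
    intro w _
    rw [mul_assoc (TW w) (phi R q r (m w)), phi_T, mul_add, mul_smul_comm, mul_assoc]
  | hC j =>
    intro m
    rw [rep_C]
    rw [mu_apply, mu_apply, Finset.sum_mul]
    apply Finset.sum_congr rfl
    intro w _
    change TW w * phi R q r (m w * cgen R r j) = _
    rw [map_mul, phi_c, mul_assoc]
  | hadd x y hx hy =>
    intro m
    rw [map_add, unop_add, LinearMap.add_apply, map_add, hx, hy, mul_add]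
  | hmul x y hx hy =>
    intro m
    rw [map_mul, unop_mul, Module.End.mul_apply, hy, hx, mul_assoc]


/-- the coordinate map -/
noncomputable def pr (h : HC R q r) : Mod r (CA R r) :=
  (rep theData q h).unop (eVec r (CA R r))

lemma pr_mul (x y : HC R q r) : pr (x * y) = (rep theData q y).unop (pr x) := by
  rw [pr, map_mul, unop_mul, Module.End.mul_apply]; rfl

lemma lOp_rep (k : Fin (r - 1)) (h : HC R q r) : ∀ m : Mod r (CA R r),
    lOp q _ k ((rep theData q h).unop m) = (rep theData q h).unop (lOp q _ k m) := by
  induction h using HC_induct with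
  | halg a =>
    intro m
    rw [AlgHom.commutes]
    change lOp q _ k (a • m) = a • lOp q _ k m
    exact map_smul _ _ _
  | hT j => intro m; rw [rep_T]; exact lOp_tOp theData q k j m
  | hC j => intro m; rw [rep_C]; exact lOp_cOp theData q k j m
  | hadd x y hx hy =>
    intro m
    rw [map_add, unop_add, LinearMap.add_apply, LinearMap.add_apply, map_add, hx, hy]
  | hmul x y hx hy =>
    intro m
    rw [map_mul, unop_mul, Module.End.mul_apply, Module.End.mul_apply, hy, hx]

lemma pr_T_mul (k : Fin (r - 1)) (h : HC R q r) : pr (TT R q r k * h) = lOp q _ k (pr h) := by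
  rw [pr_mul]
  have : pr (TT R q r k) = lOp q _ k (eVec r (CA R r)) := by
    rw [pr, rep_T]
    change tOp theData q k (eVec r (CA R r)) = _
    rw [eVec, tOp_single_asc theData q k 1 (by simpa using lo_lt_hi k),
      lOp_single_asc q k 1 1 (by simpa using lo_lt_hi k), one_mul, mul_one]
  rw [this, ← lOp_rep]; rfl


lemma mu_pr (hTW : IsTW q r TW) (h : HC R q r) : mu TW (pr h) = h := by
  rw [pr, mu_act hTW, eVec, mu_single, hTW.1, map_one, one_mul, one_mul]

lemma pr_TW (hTW : IsTW q r TW) (w : Equiv.Perm (Fin r)) : pr (TW w) = Pi.single w 1 := by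
  revert w
  apply perm_induct
  · rw [hTW.1, pr, map_one]; rfl
  · intro w k h ih
    rw [TW_asc hTW w k h, pr_mul, ih, rep_T]
    exact tOp_single_asc theData q k w h

lemma pr_x (hTW : IsTW q r TW) {n : ℕ} (lam : Fin n → ℕ) :
    pr (xElt lam TW) = fun w => if MemYoung lam w then (1 : CA R r) else 0 := by
  have h0 : ∀ x : HC R q r, pr x = (LinearMap.applyₗ (eVec r (CA R r)) : Module.End R _ →ₗ[R] _)
    (((opLinearEquiv R).symm : _ ≃ₗ[R] _) (rep theData q x)) := fun x => rfl
  rw [h0, xElt, map_sum, map_sum, map_sum]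
  simp only [← h0]
  funext v
  rw [Finset.sum_apply, Finset.sum_eq_single v]
  · split_ifs
    · rw [pr_TW hTW]; simp
    · simp [pr]
  · intro b _ hb
    split_ifs
    · rw [pr_TW hTW]; simp [hb.symm]
    · simp [pr]
  · simp

lemma T_x (hTW : IsTW q r TW) {n : ℕ} (lam : Fin n → ℕ) (hlam : ∑ i, lam i = r) (k : Fin (r - 1))
    (hk : MemYoung lam (simpleT k : Equiv.Perm (Fin r))) :
    TT R q r k * xElt lam TW = q • xElt lam TW := by
  rw [← mu_pr hTW (TT R q r k * xElt lam TW), pr_T_mul]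
  conv_rhs => rw [← mu_pr hTW (xElt lam TW), ← map_smul]
  congr 1
  rw [pr_x hTW]
  funext w
  have : MemYoung lam (simpleT k * w) ↔ MemYoung lam w :=
    (youngSub lam hlam).mul_mem_cancel_left hk
  rw [lOp_apply, Pi.smul_apply]
  simp only [this]
  split_ifs <;> module

lemma coset_sum (hTW : IsTW q r TW) {n : ℕ} (lam : Fin n → ℕ) (hlam : ∑ i, lam i = r) :
    ∀ d : Equiv.Perm (Fin r), IsMin lam d →
      ∃ g, (∑ u, if MemYoung lam u then TW (u * d) else 0) = xElt lam TW * g := by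
  have : ∀ l, ∀ d : Equiv.Perm (Fin r), len d = l → IsMin lam d →
      ∃ g, (∑ u, if MemYoung lam u then TW (u * d) else 0) = xElt lam TW * g := by
    intro l
    induction l using Nat.strong_induction_on with
    | _ l ih =>
      intro d hl hd
      by_cases hd1 : d = 1
      · exact ⟨1, by simp [hd1, xElt]⟩
      · obtain ⟨k, hk⟩ := exists_desc d hd1
        have hlt := len_desc d k hk
        have hmin : IsMin lam (d * simpleT k) := by
          intro i hi
          rw [mul_inv_rev, simpleT_inv]
          apply simpleT_lt k (hd i hi)
          rintro ⟨h1, h2⟩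
          rw [Equiv.Perm.inv_eq_iff_eq] at h1 h2
          rw [← h1, ← h2] at hk
          exact absurd hk (lo_lt_hi i).asymm
        obtain ⟨g, hg⟩ := ih _ (by omega) (d * simpleT k) rfl hmin
        refine ⟨g * TT R q r k, ?_⟩
        rw [← mul_assoc, ← hg, Finset.sum_mul]
        apply Finset.sum_congr rfl
        intro u _
        split_ifs with hu
        · rw [← TW_asc hTW, mul_assoc, ← desc_eq]
          simp only [Equiv.Perm.mul_apply, simpleT_lo, simpleT_hi]
          apply young_lt lam hlam hu hk
          intro a ha hb
          have := hd.lt lam _ _ ha hb hk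
          simp only [Equiv.Perm.inv_def, Equiv.symm_apply_apply] at this
          exact absurd this (lo_lt_hi k).asymm
        · simp
  exact fun d => this _ d rfl

lemma inv_sum (hTW : IsTW q r TW) {n : ℕ} (lam : Fin n → ℕ) (hlam : ∑ i, lam i = r) (m : Mod r (CA R r))
    (hm : ∀ u, MemYoung lam u → ∀ w, m (u * w) = m w) :
    ∃ g, mu TW m = xElt lam TW * g := by
  classical
  let Q := Quotient (QuotientGroup.rightRel (youngSub lam hlam))
  have hrep : ∀ c : Q, ∃ d, IsMin lam d ∧ (Quotient.mk _ d : Q) = c := by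
    intro c
    induction c using Quotient.inductionOn with
    | _ w =>
      obtain ⟨u, hu, hmin⟩ := exists_min lam hlam w
      refine ⟨u * w, hmin, Quotient.sound ?_⟩
      change QuotientGroup.rightRel _ _ _
      rw [QuotientGroup.rightRel_apply, mul_inv_rev, mul_inv_cancel_left]
      exact (youngSub lam hlam).inv_mem hu
  choose d hd hdc using hrep
  choose g hg using fun c => coset_sum hTW lam hlam (d c) (hd c)
  refine ⟨∑ c : Q, g c * phi R q r (m (d c)), ?_⟩
  rw [mu_apply, Finset.mul_sum,
    ← Finset.sum_fiberwise (s := Finset.univ) (g := fun w => (Quotient.mk _ w : Q))]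
  apply Finset.sum_congr rfl
  intro c _
  rw [← mul_assoc, ← hg, Finset.sum_filter, Finset.sum_mul,
    ← Equiv.sum_comp (Equiv.mulRight (d c))]
  apply Finset.sum_congr rfl
  intro u _
  have hiff : (Quotient.mk _ (u * d c) : Q) = c ↔ MemYoung lam u := by
    conv_lhs => rhs; rw [← hdc c]
    rw [eq_comm, Quotient.eq]
    change QuotientGroup.rightRel _ _ _ ↔ _
    rw [QuotientGroup.rightRel_apply, mul_inv_cancel_right]
    rfl
  simp only [Equiv.coe_mulRight, hiff]
  split_ifs with hu
  · rw [hm u hu]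
  · simp

end Final

end HCPaper

open HCPaper in
/-- `x_λ H^c_{r,R} = {h : T_{s_k} h = q h for all s_k ∈ S_λ}`. -/
theorem stmt13 (R : Type) [CommRing R] (h2 : ringChar R ≠ 2) (q : R) (r n : ℕ)
    (lam : Fin n → ℕ) (hlam : ∑ i, lam i = r)
    (TW : Equiv.Perm (Fin r) → HC R q r) (hTW : IsTW q r TW) :
    Set.range (fun h : HC R q r => xElt lam TW * h)
      = {h : HC R q r | ∀ k : Fin (r - 1), MemYoung lam (simpleT k) →
          TT R q r k * h = algebraMap R (HC R q r) q * h} := by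
  ext h
  simp only [Set.mem_range, Set.mem_setOf_eq]
  constructor
  · rintro ⟨g, rfl⟩ k hk
    rw [← mul_assoc, T_x hTW lam hlam k hk, Algebra.smul_def, mul_assoc]
  · intro hh
    obtain ⟨g, hg⟩ := inv_sum hTW lam hlam (pr h) (young_inv lam hlam (pr h) (by
      intro k hk
      have h1 := congrArg pr (hh k hk)
      have h3 : pr (algebraMap R (HC R q r) q * h) = q • pr h := by
        rw [← Algebra.smul_def, pr, map_smul]; rfl
      rw [pr_T_mul, h3] at h1
      have key : ∀ w : Equiv.Perm (Fin r), ¬ w⁻¹ (loIdx k) < w⁻¹ (hiIdx k) →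
          pr h (simpleT k * w) = pr h w := by
        intro w hw
        have h4 := congrFun h1 w
        rw [lOp_apply, if_neg hw, Pi.smul_apply] at h4
        exact eq_of_smul q _ _ h4
      intro w
      by_cases hw : w⁻¹ (loIdx k) < w⁻¹ (hiIdx k)
      · have := key (simpleT k * w) (by rw [asc_left]; exact not_not.2 hw)
        rw [← mul_assoc, simpleT_sq, one_mul] at this
        exact this.symm
      · exact key w hw))
    rw [mu_pr hTW] at hg
    exact ⟨g, hg.symm⟩
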